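/- Let s > 2 and let θ ∈ H^s(ℝ²), u₂ = −∂₁²(−Δ)^{−1}θ = R₁²θ. Then there exists C = C(s) > 0 such that the anisotropic commutator satisfies |∫_{ℝ²} (Λ^{s−2}∂₂²(u₂ ∂₂θ) − u₂ Λ^{s−2}∂₂³θ) Λ^{s−2}∂₂²θ dx| ≤ C ‖|ξ| ℱu₂‖_{L¹} ‖θ‖²_{H^s} + C ‖R₁θ‖²_{H^s} ‖θ‖_{H^s}. -/

import Mathlib

open MeasureTheory Real FourierTransform SchwartzMap Complex

theorem rpow_sub_rpow_le {q a b : ℝ} (hq : 1 ≤ q) (hb : 0 ≤ b) (hab : b ≤ a) :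
    a ^ q - b ^ q ≤ q * (a - b) * a ^ (q - 1) := by
  rcases (hb.trans hab).eq_or_lt with h | ha
  · have : b = 0 := by linarith
    subst this; simp [← h]
  have h1 : -1 ≤ (b - a) / a := by rw [le_div_iff₀ ha]; linarith
  have h2 := one_add_mul_self_le_rpow_one_add h1 hq
  have h3 : 1 + (b - a) / a = b / a := by field_simp; ring
  rw [h3, Real.div_rpow hb ha.le, le_div_iff₀ (by positivity)] at h2
  have h4 : a ^ q = a ^ (q - 1) * a := by
    rw [← Real.rpow_add_one ha.ne']; ring_nf
  have h5 : (1 + q * ((b - a) / a)) * a ^ q = a ^ q - q * (a - b) * a ^ (q - 1) := by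
    rw [h4]; field_simp; ring
  linarith

theorem symbol_sub_le_of_norm_le {s : ℝ} (hs : 2 < s) {ξ ζ : EuclideanSpace ℝ (Fin 2)}
    (h : ‖ζ‖ ≤ ‖ξ‖) :
    |‖ξ‖ ^ (s - 2) * ξ 1 ^ 2 - ‖ζ‖ ^ (s - 2) * ζ 1 ^ 2| ≤
      (s + 2) * ‖ξ - ζ‖ * ‖ξ‖ ^ (s - 1) := by
  rcases (norm_nonneg ξ).eq_or_lt with h0 | h0
  · have h1 : ξ = 0 := by simpa using h0.symm
    have h2 : ζ = 0 := by simpa [h1] using h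
    simp [h1, h2]
  have hξ : |ξ 1| ≤ ‖ξ‖ := PiLp.norm_apply_le ξ 1
  have hζ : |ζ 1| ≤ ‖ζ‖ := PiLp.norm_apply_le ζ 1
  have hd : |ξ 1 - ζ 1| ≤ ‖ξ - ζ‖ := PiLp.norm_apply_le (ξ - ζ) 1
  have hn : ‖ξ‖ - ‖ζ‖ ≤ ‖ξ - ζ‖ := norm_sub_norm_le ξ ζ
  have e1 : ‖ξ‖ ^ (s - 1) = ‖ξ‖ ^ (s - 2) * ‖ξ‖ := by
    rw [← Real.rpow_add_one h0.ne']; ring_nf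
  have e2 : ‖ξ‖ ^ s = ‖ξ‖ ^ (s - 2) * ‖ξ‖ ^ 2 := by
    rw [← Real.rpow_natCast, ← Real.rpow_add h0]; norm_num
  have e3 : ‖ζ‖ ^ s = ‖ζ‖ ^ (s - 2) * ‖ζ‖ ^ 2 := by
    rw [← Real.rpow_natCast, ← Real.rpow_add' (norm_nonneg _) (by norm_num; linarith)]; norm_num
  have hmono : ‖ζ‖ ^ (s - 2) ≤ ‖ξ‖ ^ (s - 2) :=
    Real.rpow_le_rpow (norm_nonneg _) h (by linarith)
  have hsplit : ‖ξ‖ ^ (s - 2) * ξ 1 ^ 2 - ‖ζ‖ ^ (s - 2) * ζ 1 ^ 2 =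
      ‖ξ‖ ^ (s - 2) * ((ξ 1 - ζ 1) * (ξ 1 + ζ 1)) +
        (‖ξ‖ ^ (s - 2) - ‖ζ‖ ^ (s - 2)) * ζ 1 ^ 2 := by ring
  have hA : |‖ξ‖ ^ (s - 2) * ((ξ 1 - ζ 1) * (ξ 1 + ζ 1))| ≤
      ‖ξ‖ ^ (s - 2) * (‖ξ - ζ‖ * (2 * ‖ξ‖)) := by
    rw [abs_mul, abs_mul, abs_of_nonneg (by positivity : 0 ≤ ‖ξ‖ ^ (s - 2))]
    have : |ξ 1 + ζ 1| ≤ 2 * ‖ξ‖ := (abs_add_le _ _).trans (by linarith)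
    gcongr
  have hB : |(‖ξ‖ ^ (s - 2) - ‖ζ‖ ^ (s - 2)) * ζ 1 ^ 2| ≤ s * ‖ξ - ζ‖ * ‖ξ‖ ^ (s - 1) := by
    rw [abs_of_nonneg (mul_nonneg (by linarith) (by positivity))]
    calc (‖ξ‖ ^ (s - 2) - ‖ζ‖ ^ (s - 2)) * ζ 1 ^ 2
        ≤ (‖ξ‖ ^ (s - 2) - ‖ζ‖ ^ (s - 2)) * ‖ζ‖ ^ 2 := by
          have : ζ 1 ^ 2 ≤ ‖ζ‖ ^ 2 := by rw [← sq_abs]; gcongr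
          exact mul_le_mul_of_nonneg_left this (by linarith)
      _ ≤ ‖ξ‖ ^ s - ‖ζ‖ ^ s := by
          rw [e2, e3, sub_mul]; gcongr
      _ ≤ s * (‖ξ‖ - ‖ζ‖) * ‖ξ‖ ^ (s - 1) :=
          rpow_sub_rpow_le (by linarith) (norm_nonneg _) h
      _ ≤ s * ‖ξ - ζ‖ * ‖ξ‖ ^ (s - 1) := by gcongr
  rw [hsplit]
  calc _ ≤ _ := abs_add_le _ _
    _ ≤ _ := add_le_add hA hB
    _ = _ := by rw [e1]; ring

theorem symbol_sub_le {s : ℝ} (hs : 2 < s) (ξ ζ : EuclideanSpace ℝ (Fin 2)) :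
    |‖ξ‖ ^ (s - 2) * ξ 1 ^ 2 - ‖ζ‖ ^ (s - 2) * ζ 1 ^ 2| ≤
      (s + 2) * ‖ξ - ζ‖ * max ‖ξ‖ ‖ζ‖ ^ (s - 1) := by
  rcases le_total ‖ζ‖ ‖ξ‖ with h | h
  · rw [max_eq_left h]; exact symbol_sub_le_of_norm_le hs h
  · rw [max_eq_right h, abs_sub_comm, norm_sub_rev]; exact symbol_sub_le_of_norm_le hs h

theorem symbol_abs_le {s : ℝ} (hs : 2 < s) (ξ : EuclideanSpace ℝ (Fin 2)) :
    |‖ξ‖ ^ (s - 2) * ξ 1 ^ 2| ≤ ‖ξ‖ ^ s := by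
  have hξ : |ξ 1| ≤ ‖ξ‖ := PiLp.norm_apply_le ξ 1
  have e : ‖ξ‖ ^ s = ‖ξ‖ ^ (s - 2) * ‖ξ‖ ^ 2 := by
    rw [← Real.rpow_natCast, ← Real.rpow_add' (norm_nonneg _) (by norm_num; linarith)]; norm_num
  rw [abs_of_nonneg (by positivity), e, ← sq_abs (ξ 1)]
  gcongr

/-- Pointwise bound of the commutator symbol: either the transported frequency dominates, or the
smallness of the symbol of `R₁` at `η` can be shared with one of the other two frequencies. -/
theorem commutator_symbol_le {s : ℝ} (hs : 2 < s) (ξ η ζ : EuclideanSpace ℝ (Fin 2))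
    (hξ : ξ = ζ + η) :
    |‖ξ‖ ^ (s - 2) * ξ 1 ^ 2 - ‖ζ‖ ^ (s - 2) * ζ 1 ^ 2| * (|η 0| / ‖η‖) ^ 2 * |ζ 1| *
        |‖ξ‖ ^ (s - 2) * ξ 1 ^ 2| ≤
      (s + 2) * 2 ^ (s - 1) *
        (‖η‖ * (|η 0| / ‖η‖) ^ 2 * ‖ζ‖ ^ s * ‖ξ‖ ^ s +
          2 * (‖η‖ ^ s * (|η 0| / ‖η‖) * ‖ζ‖ * (‖ξ‖ ^ s * (|ξ 0| / ‖ξ‖))) +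
          ‖η‖ ^ s * (|η 0| / ‖η‖) * (‖ζ‖ * (|ζ 0| / ‖ζ‖)) * ‖ξ‖ ^ s) := by
  have hm := symbol_sub_le hs ξ ζ
  have hb := symbol_abs_le hs ξ
  have hd : ξ - ζ = η := by rw [hξ]; abel
  rw [hd] at hm
  have hζ1 : |ζ 1| ≤ ‖ζ‖ := PiLp.norm_apply_le ζ 1
  have hn : ‖ξ‖ ≤ ‖ζ‖ + ‖η‖ := by rw [hξ]; exact norm_add_le _ _
  rcases le_total ‖η‖ ‖ζ‖ with h | h
  · have hM : max ‖ξ‖ ‖ζ‖ ≤ 2 * ‖ζ‖ := max_le (by linarith) (by linarith [norm_nonneg ζ])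
    have e : ‖ζ‖ ^ s = ‖ζ‖ ^ (s - 1) * ‖ζ‖ := by
      rw [← Real.rpow_add_one' (norm_nonneg _) (by linarith)]; ring_nf
    calc _ ≤ ((s + 2) * ‖η‖ * (2 * ‖ζ‖) ^ (s - 1)) * (|η 0| / ‖η‖) ^ 2 * ‖ζ‖ * ‖ξ‖ ^ s := by
          have hp : max ‖ξ‖ ‖ζ‖ ^ (s - 1) ≤ (2 * ‖ζ‖) ^ (s - 1) :=
            Real.rpow_le_rpow (by positivity) hM (by linarith)
          have := hm.trans (mul_le_mul_of_nonneg_left hp (by positivity))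
          gcongr
      _ = (s + 2) * 2 ^ (s - 1) * (‖η‖ * (|η 0| / ‖η‖) ^ 2 * ‖ζ‖ ^ s * ‖ξ‖ ^ s) := by
          rw [Real.mul_rpow (by norm_num) (norm_nonneg _), e]; ring
      _ ≤ _ := by
          rw [add_assoc]
          exact mul_le_mul_of_nonneg_left (le_add_of_nonneg_right (by positivity)) (by positivity)
  · have hM : max ‖ξ‖ ‖ζ‖ ≤ 2 * ‖η‖ := max_le (by linarith) (by linarith [norm_nonneg η])
    have e : ‖η‖ ^ s = ‖η‖ ^ (s - 1) * ‖η‖ := by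
      rw [← Real.rpow_add_one' (norm_nonneg _) (by linarith)]; ring_nf
    have hkey : ‖ζ‖ * ‖ξ‖ ^ s * (|η 0| / ‖η‖) ≤
        2 * (‖ζ‖ * (‖ξ‖ ^ s * (|ξ 0| / ‖ξ‖))) + ‖ζ‖ * (|ζ 0| / ‖ζ‖) * ‖ξ‖ ^ s := by
      rcases (norm_nonneg ξ).eq_or_lt with h1 | h1
      · rw [← h1, Real.zero_rpow (by linarith)]; simp
      rcases (norm_nonneg ζ).eq_or_lt with h2 | h2
      · simp [← h2]
      have h3 : 0 < ‖η‖ := h2.trans_le h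
      have h4 : |η 0| ≤ |ξ 0| + |ζ 0| := by
        rw [← hd]; exact abs_sub (ξ 0) (ζ 0)
      have h5 : |η 0| / ‖η‖ ≤ 2 * (|ξ 0| / ‖ξ‖) + |ζ 0| / ‖ζ‖ := by
        calc |η 0| / ‖η‖ ≤ (|ξ 0| + |ζ 0|) / ‖η‖ := by gcongr
          _ = |ξ 0| / ‖η‖ + |ζ 0| / ‖η‖ := add_div _ _ _
          _ ≤ |ξ 0| / (‖ξ‖ / 2) + |ζ 0| / ‖ζ‖ := by
              gcongr
              linarith
          _ = _ := by field_simp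
      calc _ ≤ ‖ζ‖ * ‖ξ‖ ^ s * (2 * (|ξ 0| / ‖ξ‖) + |ζ 0| / ‖ζ‖) := by gcongr
        _ = _ := by ring
    calc _ ≤ ((s + 2) * ‖η‖ * (2 * ‖η‖) ^ (s - 1)) * (|η 0| / ‖η‖) ^ 2 * ‖ζ‖ * ‖ξ‖ ^ s := by
          have hp : max ‖ξ‖ ‖ζ‖ ^ (s - 1) ≤ (2 * ‖η‖) ^ (s - 1) :=
            Real.rpow_le_rpow (by positivity) hM (by linarith)
          have := hm.trans (mul_le_mul_of_nonneg_left hp (by positivity))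
          gcongr
      _ = (s + 2) * 2 ^ (s - 1) * (‖η‖ ^ s * (|η 0| / ‖η‖) *
            (‖ζ‖ * ‖ξ‖ ^ s * (|η 0| / ‖η‖))) := by
          rw [Real.mul_rpow (by norm_num) (norm_nonneg _), e]; ring
      _ ≤ (s + 2) * 2 ^ (s - 1) * (‖η‖ ^ s * (|η 0| / ‖η‖) *
            (2 * (‖ζ‖ * (‖ξ‖ ^ s * (|ξ 0| / ‖ξ‖))) + ‖ζ‖ * (|ζ 0| / ‖ζ‖) * ‖ξ‖ ^ s)) := by
          gcongr
      _ ≤ _ := by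
          gcongr
          have : 0 ≤ ‖η‖ * (|η 0| / ‖η‖) ^ 2 * ‖ζ‖ ^ s * ‖ξ‖ ^ s := by positivity
          linarith

section Young
open scoped ENNReal

variable {V : Type*} [AddCommGroup V] [MeasurableSpace V] [MeasurableAdd₂ V] [MeasurableNeg V]
  {μ : Measure V} [SFinite μ] [μ.IsAddLeftInvariant]

theorem lintegral_convolution_mul_le {a b c : V → ℝ≥0∞} (ha : Measurable a) (hb : Measurable b)
    (hc : Measurable c) :
    ∫⁻ ξ, ∫⁻ η, a η * b (ξ - η) * c ξ ∂μ ∂μ ≤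
      (∫⁻ x, a x ∂μ) *
        ((∫⁻ x, b x ^ (2 : ℝ) ∂μ) ^ (1 / 2 : ℝ) * (∫⁻ x, c x ^ (2 : ℝ) ∂μ) ^ (1 / 2 : ℝ)) := by
  rw [lintegral_lintegral_swap (by fun_prop)]
  rw [← lintegral_mul_const _ ha]
  refine lintegral_mono fun η => ?_
  simp only [mul_assoc]
  rw [lintegral_const_mul _ (by fun_prop)]
  gcongr
  have := ENNReal.lintegral_mul_le_Lp_mul_Lq μ Real.HolderConjugate.two_two
    (f := fun ξ => b (ξ - η)) (g := c) (by fun_prop) (by fun_prop)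
  rwa [lintegral_sub_right_eq_self (fun x => b x ^ (2 : ℝ)) η] at this

theorem lintegral_convolution_mul_le' [μ.IsNegInvariant] {a b c : V → ℝ≥0∞} (ha : Measurable a) (hb : Measurable b)
    (hc : Measurable c) :
    ∫⁻ ξ, ∫⁻ η, a η * b (ξ - η) * c ξ ∂μ ∂μ ≤
      (∫⁻ x, b x ∂μ) *
        ((∫⁻ x, a x ^ (2 : ℝ) ∂μ) ^ (1 / 2 : ℝ) * (∫⁻ x, c x ^ (2 : ℝ) ∂μ) ^ (1 / 2 : ℝ)) := by
  refine le_of_eq_of_le ?_ (lintegral_convolution_mul_le hb ha hc)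
  refine lintegral_congr fun ξ => ?_
  rw [← lintegral_sub_left_eq_self _ ξ]
  simp [mul_comm]

end Young

theorem integrable_weight_mul_norm_sq (f : 𝓢(EuclideanSpace ℝ (Fin 2), ℂ)) {s : ℝ} (hs : 0 ≤ s) :
    Integrable fun x => (1 + ‖x‖ ^ 2) ^ s * ‖f x‖ ^ 2 := by
  obtain ⟨M, hM, hfM⟩ := f.decay 0 0
  set n := ⌈s⌉₊
  have hint : Integrable fun x => 2 ^ (n - 1) * M * (‖x‖ ^ 0 * ‖f x‖ + ‖x‖ ^ (2 * n) * ‖f x‖) :=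
    ((f.integrable_pow_mul volume 0).add (f.integrable_pow_mul volume (2 * n))).const_mul _
  refine hint.mono' ?_ (ae_of_all _ fun x => ?_)
  · have := f.continuous
    have h : Continuous fun x : EuclideanSpace ℝ (Fin 2) => (1 + ‖x‖ ^ 2) ^ s :=
      (by fun_prop : Continuous fun x : EuclideanSpace ℝ (Fin 2) => 1 + ‖x‖ ^ 2).rpow_const
        fun x => Or.inr hs
    exact (h.mul (by fun_prop)).aestronglyMeasurable
  · have h1 : ‖f x‖ ≤ M := by simpa using hfM x
    have h2 : (1 + ‖x‖ ^ 2) ^ s ≤ 2 ^ (n - 1) * (1 + ‖x‖ ^ (2 * n)) := by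
      calc (1 + ‖x‖ ^ 2) ^ s ≤ (1 + ‖x‖ ^ 2) ^ (n : ℝ) :=
            Real.rpow_le_rpow_of_exponent_le (by nlinarith [norm_nonneg x]) (Nat.le_ceil s)
        _ = (1 + ‖x‖ ^ 2) ^ n := Real.rpow_natCast _ _
        _ ≤ 2 ^ (n - 1) * (1 ^ n + (‖x‖ ^ 2) ^ n) := add_pow_le (by norm_num) (by positivity) n
        _ = _ := by rw [one_pow, pow_mul]
    rw [Real.norm_of_nonneg (by positivity)]
    calc (1 + ‖x‖ ^ 2) ^ s * ‖f x‖ ^ 2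
        ≤ (2 ^ (n - 1) * (1 + ‖x‖ ^ (2 * n))) * (‖f x‖ * M) := by
          have h3 : ‖f x‖ ^ 2 ≤ ‖f x‖ * M := by rw [sq]; gcongr
          gcongr
      _ = _ := by ring

theorem abs_coord_div_norm_le_one (x : EuclideanSpace ℝ (Fin 2)) : |x 0| / ‖x‖ ≤ 1 :=
  div_le_one_of_le₀ (PiLp.norm_apply_le x 0) (norm_nonneg x)

theorem two_mul_ofReal (x : ℝ) : 2 * ENNReal.ofReal x = ENNReal.ofReal (2 * x) := by
  rw [ENNReal.ofReal_mul zero_le_two, ENNReal.ofReal_ofNat]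

theorem lintegral_ofReal_rpow_two {f g : EuclideanSpace ℝ (Fin 2) → ℝ} (hf : ∀ x, 0 ≤ f x)
    (hfg : ∀ x, f x ^ 2 = g x) (hg : Integrable g) :
    (∫⁻ x, ENNReal.ofReal (f x) ^ (2 : ℝ)) ^ (1 / 2 : ℝ) =
      ENNReal.ofReal ((∫ x, g x) ^ (1 / 2 : ℝ)) := by
  have hg0 : ∀ x, 0 ≤ g x := fun x => hfg x ▸ sq_nonneg _
  rw [← ENNReal.ofReal_rpow_of_nonneg (integral_nonneg hg0) (by norm_num),
    ofReal_integral_eq_lintegral_ofReal hg (ae_of_all _ hg0)]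
  congr 2
  ext x
  rw [ENNReal.ofReal_rpow_of_nonneg (hf x) (by norm_num), ← hfg x, Real.rpow_two]

set_option maxHeartbeats 800000 in
/-- The commutator estimate on the Fourier side, with an explicit constant. -/
theorem commutator_integral_le {s : ℝ} (hs : 2 < s) (f : 𝓢(EuclideanSpace ℝ (Fin 2), ℂ))
    {Φ : EuclideanSpace ℝ (Fin 2) → EuclideanSpace ℝ (Fin 2) → ℂ} {K : ℝ} (hK : 0 ≤ K)
    (hΦ : ∀ ξ η, ‖Φ ξ η‖ ≤ K *
      (|‖ξ‖ ^ (s - 2) * ξ 1 ^ 2 - ‖ξ - η‖ ^ (s - 2) * (ξ - η) 1 ^ 2| * (|η 0| / ‖η‖) ^ 2 *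
        |(ξ - η) 1| * |‖ξ‖ ^ (s - 2) * ξ 1 ^ 2|) * (‖f η‖ * ‖f (ξ - η)‖ * ‖f ξ‖)) :
    ‖∫ ξ, ∫ η, Φ ξ η‖ ≤ K * ((s + 2) * 2 ^ (s - 1)) *
      ((∫ η, ‖η‖ * ((|η 0| / ‖η‖) ^ 2 * ‖f η‖)) *
          ((∫ ξ, (1 + ‖ξ‖ ^ 2) ^ s * ‖f ξ‖ ^ 2) ^ (1 / 2 : ℝ)) ^ 2 +
        3 * (∫ x : EuclideanSpace ℝ (Fin 2), (1 + ‖x‖ ^ 2) ^ (1 - s)) ^ (1 / 2 : ℝ) *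
          ((∫ ξ, (1 + ‖ξ‖ ^ 2) ^ s * (ξ 0 ^ 2 / ‖ξ‖ ^ 2) * ‖f ξ‖ ^ 2) ^ (1 / 2 : ℝ)) ^ 2 *
          (∫ ξ, (1 + ‖ξ‖ ^ 2) ^ s * ‖f ξ‖ ^ 2) ^ (1 / 2 : ℝ)) := by
  have hfc := f.continuous
  have hcoord : Measurable fun x : EuclideanSpace ℝ (Fin 2) => x 0 :=
    (by fun_prop : Continuous fun x : EuclideanSpace ℝ (Fin 2) => x 0).measurable
  have hintA := integrable_weight_mul_norm_sq f (s := s) (by linarith)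
  have hintB : Integrable fun ξ => (1 + ‖ξ‖ ^ 2) ^ s * (ξ 0 ^ 2 / ‖ξ‖ ^ 2) * ‖f ξ‖ ^ 2 := by
    refine hintA.mono' (by fun_prop) (ae_of_all _ fun x => ?_)
    rw [Real.norm_of_nonneg (by positivity), ← sq_abs (x 0), ← div_pow]
    have := pow_le_one₀ (n := 2) (by positivity) (abs_coord_div_norm_le_one x)
    have h0 : 0 ≤ (1 + ‖x‖ ^ 2) ^ s := by positivity
    gcongr
    exact mul_le_of_le_one_right h0 this
  have hintX : Integrable fun η => ‖η‖ * ((|η 0| / ‖η‖) ^ 2 * ‖f η‖) := by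
    have hmeas : Measurable fun η => ‖η‖ * ((|η 0| / ‖η‖) ^ 2 * ‖f η‖) := by fun_prop
    refine (f.integrable_pow_mul volume 1).mono' hmeas.aestronglyMeasurable
      (ae_of_all _ fun x => ?_)
    rw [Real.norm_of_nonneg (by positivity), pow_one]
    have := pow_le_one₀ (n := 2) (by positivity) (abs_coord_div_norm_le_one x)
    gcongr
    exact mul_le_of_le_one_left (norm_nonneg _) this
  have hintW : Integrable fun x : EuclideanSpace ℝ (Fin 2) => (1 + ‖x‖ ^ 2) ^ (1 - s) := by
    have := integrable_rpow_neg_one_add_norm_sq (E := EuclideanSpace ℝ (Fin 2)) (μ := volume)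
      (r := 2 * s - 2) (by simp; linarith)
    convert this using 3
    ring
  set h : EuclideanSpace ℝ (Fin 2) → ℝ := fun x => (1 + ‖x‖ ^ 2) ^ (s / 2) * ‖f x‖ with h_def
  set r : EuclideanSpace ℝ (Fin 2) → ℝ := fun x => |x 0| / ‖x‖ with r_def
  set w : EuclideanSpace ℝ (Fin 2) → ℝ := fun x => (1 + ‖x‖ ^ 2) ^ ((1 - s) / 2) with w_def
  set a : EuclideanSpace ℝ (Fin 2) → ℝ := fun η => ‖η‖ * ((|η 0| / ‖η‖) ^ 2 * ‖f η‖) with a_def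
  have hh0 : ∀ x, 0 ≤ h x := fun x => by positivity
  have hr0 : ∀ x, 0 ≤ r x := fun x => by positivity
  have hw0 : ∀ x, 0 ≤ w x := fun x => by positivity
  have ha0 : ∀ x, 0 ≤ a x := fun x => by positivity
  have hhm : Measurable h := by fun_prop
  have hrm : Measurable r := by fun_prop
  have hwm : Measurable w := by fun_prop
  have ham : Measurable a := by fun_prop
  have hJ : ∀ x : EuclideanSpace ℝ (Fin 2), ‖x‖ ^ s ≤ (1 + ‖x‖ ^ 2) ^ (s / 2) := fun x => by
    calc ‖x‖ ^ s = (‖x‖ ^ 2) ^ (s / 2) := by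
          rw [← Real.rpow_natCast, ← Real.rpow_mul (norm_nonneg _)]; congr 1; push_cast; ring
      _ ≤ _ := Real.rpow_le_rpow (by positivity) (by linarith) (by linarith)
  have hwJ : ∀ x : EuclideanSpace ℝ (Fin 2), ‖x‖ ≤ w x * (1 + ‖x‖ ^ 2) ^ (s / 2) := fun x => by
    rw [w_def]
    simp only
    rw [← Real.rpow_add (by positivity)]
    ring_nf
    rw [← Real.sqrt_eq_rpow]
    exact Real.le_sqrt_of_sq_le (by linarith)
  have hpt : ∀ ξ η, ‖Φ ξ η‖ ≤ K * ((s + 2) * 2 ^ (s - 1)) *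
      (a η * h (ξ - η) * h ξ + 2 * ((h η * r η) * (w (ξ - η) * h (ξ - η)) * (h ξ * r ξ)) +
        (h η * r η) * (w (ξ - η) * (h (ξ - η) * r (ξ - η))) * h ξ) := fun ξ η => by
    have h1 := commutator_symbol_le hs ξ η (ξ - η) (by abel)
    have hwη := hw0 (ξ - η)
    calc ‖Φ ξ η‖ ≤ _ := hΦ ξ η
      _ ≤ K * ((s + 2) * 2 ^ (s - 1) *
        (‖η‖ * (|η 0| / ‖η‖) ^ 2 * (1 + ‖ξ - η‖ ^ 2) ^ (s / 2) * (1 + ‖ξ‖ ^ 2) ^ (s / 2) +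
          2 * ((1 + ‖η‖ ^ 2) ^ (s / 2) * (|η 0| / ‖η‖) *
            (w (ξ - η) * (1 + ‖ξ - η‖ ^ 2) ^ (s / 2)) *
            ((1 + ‖ξ‖ ^ 2) ^ (s / 2) * (|ξ 0| / ‖ξ‖))) +
          (1 + ‖η‖ ^ 2) ^ (s / 2) * (|η 0| / ‖η‖) *
            ((w (ξ - η) * (1 + ‖ξ - η‖ ^ 2) ^ (s / 2)) * (|(ξ - η) 0| / ‖ξ - η‖)) *
            (1 + ‖ξ‖ ^ 2) ^ (s / 2))) * (‖f η‖ * ‖f (ξ - η)‖ * ‖f ξ‖) := by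
        have e1 := hJ ξ
        have e2 := hJ η
        have e3 := hJ (ξ - η)
        have e4 := hwJ (ξ - η)
        have h2 : 0 ≤ (s + 2) * 2 ^ (s - 1) := by positivity
        refine mul_le_mul_of_nonneg_right (mul_le_mul_of_nonneg_left
          (h1.trans (mul_le_mul_of_nonneg_left (add_le_add (add_le_add ?_ ?_) ?_) h2)) hK)
          (by positivity)
        · gcongr
        · gcongr
        · gcongr ?_ * _ * ?_ * ?_
          rw [mul_comm, mul_comm (w _ * _)]
          gcongr
      _ = _ := by simp only [h_def, r_def, a_def]; ring
  have hNA : (∫⁻ x, ENNReal.ofReal (h x) ^ (2 : ℝ)) ^ (1 / 2 : ℝ) = _ :=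
    lintegral_ofReal_rpow_two hh0 (fun x => by
      rw [h_def]; simp only
      rw [mul_pow, ← Real.rpow_natCast _ 2, ← Real.rpow_mul (by positivity)]
      congr 2; push_cast; ring) hintA
  have hNB : (∫⁻ x, ENNReal.ofReal (h x * r x) ^ (2 : ℝ)) ^ (1 / 2 : ℝ) = _ :=
    lintegral_ofReal_rpow_two (fun x => mul_nonneg (hh0 x) (hr0 x)) (fun x => by
      rw [h_def, r_def]; simp only
      rw [mul_pow, mul_pow, ← Real.rpow_natCast _ 2, ← Real.rpow_mul (by positivity), div_pow,
        sq_abs, mul_right_comm]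
      congr 3; push_cast; ring) hintB
  have hNW : (∫⁻ x, ENNReal.ofReal (w x) ^ (2 : ℝ)) ^ (1 / 2 : ℝ) = _ :=
    lintegral_ofReal_rpow_two hw0 (fun x => by
      rw [w_def]; simp only
      rw [← Real.rpow_natCast _ 2, ← Real.rpow_mul (by positivity)]
      congr 1; push_cast; ring) hintW
  have hX : ∫⁻ x, ENNReal.ofReal (a x) = ENNReal.ofReal (∫ x, a x) :=
    (ofReal_integral_eq_lintegral_ofReal hintX (ae_of_all _ ha0)).symm
  set A := (∫ ξ, (1 + ‖ξ‖ ^ 2) ^ s * ‖f ξ‖ ^ 2) ^ (1 / 2 : ℝ)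
  set B := (∫ ξ, (1 + ‖ξ‖ ^ 2) ^ s * (ξ 0 ^ 2 / ‖ξ‖ ^ 2) * ‖f ξ‖ ^ 2) ^ (1 / 2 : ℝ)
  set W := (∫ x : EuclideanSpace ℝ (Fin 2), (1 + ‖x‖ ^ 2) ^ (1 - s)) ^ (1 / 2 : ℝ)
  set X := ∫ x, a x
  have hA0 : 0 ≤ A := Real.rpow_nonneg (integral_nonneg fun x => by positivity) _
  have hB0 : 0 ≤ B := Real.rpow_nonneg (integral_nonneg fun x => by positivity) _
  have hW0 : 0 ≤ W := Real.rpow_nonneg (integral_nonneg fun x => by positivity) _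
  have hX0 : 0 ≤ X := integral_nonneg ha0
  have hK' : 0 ≤ K * ((s + 2) * 2 ^ (s - 1)) := mul_nonneg hK (by positivity)
  have T1 : ∫⁻ ξ, ∫⁻ η, ENNReal.ofReal (a η) * ENNReal.ofReal (h (ξ - η)) * ENNReal.ofReal (h ξ) ≤
      ENNReal.ofReal (X * A ^ 2) := by
    have := lintegral_convolution_mul_le (μ := (volume : Measure (EuclideanSpace ℝ (Fin 2))))
      (a := fun x => ENNReal.ofReal (a x))
      (b := fun x => ENNReal.ofReal (h x)) (c := fun x => ENNReal.ofReal (h x))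
      (by fun_prop) (by fun_prop) (by fun_prop)
    rwa [hNA, hX, ← ENNReal.ofReal_mul hA0, ← ENNReal.ofReal_mul hX0, ← sq] at this
  have T2 : ∫⁻ ξ, ∫⁻ η, ENNReal.ofReal (h η * r η) * ENNReal.ofReal (w (ξ - η) * h (ξ - η)) *
      ENNReal.ofReal (h ξ * r ξ) ≤ ENNReal.ofReal (W * A * (B * B)) := by
    have := lintegral_convolution_mul_le' (μ := (volume : Measure (EuclideanSpace ℝ (Fin 2))))
      (a := fun x => ENNReal.ofReal (h x * r x))
      (b := fun x => ENNReal.ofReal (w x * h x)) (c := fun x => ENNReal.ofReal (h x * r x))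
      (by fun_prop) (by fun_prop) (by fun_prop)
    have h2 := ENNReal.lintegral_mul_le_Lp_mul_Lq
      (volume : Measure (EuclideanSpace ℝ (Fin 2))) Real.HolderConjugate.two_two
      (f := fun x => ENNReal.ofReal (w x)) (g := fun x => ENNReal.ofReal (h x))
      (by fun_prop) (by fun_prop)
    simp only [Pi.mul_apply, ← ENNReal.ofReal_mul (hw0 _)] at h2
    rw [hNW, hNA, ← ENNReal.ofReal_mul hW0] at h2
    rw [hNB, ← ENNReal.ofReal_mul hB0] at this
    refine this.trans ?_
    rw [ENNReal.ofReal_mul (mul_nonneg hW0 hA0)]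
    gcongr
  have T3 : ∫⁻ ξ, ∫⁻ η, ENNReal.ofReal (h η * r η) *
      ENNReal.ofReal (w (ξ - η) * (h (ξ - η) * r (ξ - η))) *
      ENNReal.ofReal (h ξ) ≤ ENNReal.ofReal (W * B * (B * A)) := by
    have := lintegral_convolution_mul_le' (μ := (volume : Measure (EuclideanSpace ℝ (Fin 2))))
      (a := fun x => ENNReal.ofReal (h x * r x))
      (b := fun x => ENNReal.ofReal (w x * (h x * r x))) (c := fun x => ENNReal.ofReal (h x))
      (by fun_prop) (by fun_prop) (by fun_prop)
    have h2 := ENNReal.lintegral_mul_le_Lp_mul_Lq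
      (volume : Measure (EuclideanSpace ℝ (Fin 2))) Real.HolderConjugate.two_two
      (f := fun x => ENNReal.ofReal (w x)) (g := fun x => ENNReal.ofReal (h x * r x))
      (by fun_prop) (by fun_prop)
    simp only [Pi.mul_apply, ← ENNReal.ofReal_mul (hw0 _)] at h2
    rw [hNW, hNB, ← ENNReal.ofReal_mul hW0] at h2
    rw [hNB, hNA, ← ENNReal.ofReal_mul hB0] at this
    refine this.trans ?_
    rw [ENNReal.ofReal_mul (mul_nonneg hW0 hB0)]
    gcongr
  clear_value X A B W a h r w
  have main : ‖∫ ξ, ∫ η, Φ ξ η‖ₑ ≤ ENNReal.ofReal (K * ((s + 2) * 2 ^ (s - 1)) *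
      (X * A ^ 2 + 2 * (W * A * (B * B)) + W * B * (B * A))) := by
    calc ‖∫ ξ, ∫ η, Φ ξ η‖ₑ ≤ ∫⁻ ξ, ∫⁻ η, ‖Φ ξ η‖ₑ :=
          (enorm_integral_le_lintegral_enorm _).trans
            (lintegral_mono fun ξ => enorm_integral_le_lintegral_enorm _)
      _ ≤ ∫⁻ ξ, ∫⁻ η, ENNReal.ofReal (K * ((s + 2) * 2 ^ (s - 1))) *
          (ENNReal.ofReal (a η) * ENNReal.ofReal (h (ξ - η)) * ENNReal.ofReal (h ξ) +
          2 * (ENNReal.ofReal (h η * r η) * ENNReal.ofReal (w (ξ - η) * h (ξ - η)) *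
            ENNReal.ofReal (h ξ * r ξ)) +
          ENNReal.ofReal (h η * r η) * ENNReal.ofReal (w (ξ - η) * (h (ξ - η) * r (ξ - η))) *
            ENNReal.ofReal (h ξ)) := by
        refine lintegral_mono fun ξ => lintegral_mono fun η => ?_
        have n1 := ha0 η
        have n2 := hh0 η
        have n3 := hh0 ξ
        have n4 := hh0 (ξ - η)
        have n5 := hr0 η
        have n6 := hr0 ξ
        have n7 := hr0 (ξ - η)
        have n8 := hw0 (ξ - η)
        rw [← ENNReal.ofReal_mul (by positivity), ← ENNReal.ofReal_mul (by positivity),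
          ← ENNReal.ofReal_mul (by positivity), ← ENNReal.ofReal_mul (by positivity),
          ← ENNReal.ofReal_mul (by positivity), ← ENNReal.ofReal_mul (by positivity),
          two_mul_ofReal,
          ← ENNReal.ofReal_add (by positivity) (by positivity),
          ← ENNReal.ofReal_add (by positivity) (by positivity), ← ENNReal.ofReal_mul hK',
          ← ofReal_norm]
        exact ENNReal.ofReal_le_ofReal (hpt ξ η)
      _ = ENNReal.ofReal (K * ((s + 2) * 2 ^ (s - 1))) *
          ((∫⁻ ξ, ∫⁻ η,
            ENNReal.ofReal (a η) * ENNReal.ofReal (h (ξ - η)) * ENNReal.ofReal (h ξ)) +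
          2 * (∫⁻ ξ, ∫⁻ η, ENNReal.ofReal (h η * r η) * ENNReal.ofReal (w (ξ - η) * h (ξ - η)) *
            ENNReal.ofReal (h ξ * r ξ)) +
          ∫⁻ ξ, ∫⁻ η, ENNReal.ofReal (h η * r η) *
            ENNReal.ofReal (w (ξ - η) * (h (ξ - η) * r (ξ - η))) * ENNReal.ofReal (h ξ)) := by
        rw [← lintegral_const_mul _ (by fun_prop), ← lintegral_add_left (by fun_prop),
          ← lintegral_add_left (by fun_prop), ← lintegral_const_mul _ (by fun_prop)]
        refine lintegral_congr fun ξ => ?_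
        rw [← lintegral_const_mul _ (by fun_prop), ← lintegral_add_left (by fun_prop),
          ← lintegral_add_left (by fun_prop), ← lintegral_const_mul _ (by fun_prop)]
      _ ≤ _ := by
        rw [ENNReal.ofReal_mul hK', ENNReal.ofReal_add (by positivity) (by positivity),
          ENNReal.ofReal_add (by positivity) (by positivity),
          ENNReal.ofReal_mul (p := 2) (by positivity), ENNReal.ofReal_ofNat]
        gcongr
  rw [← ofReal_norm, ENNReal.ofReal_le_ofReal_iff (mul_nonneg hK' (by positivity))] at main
  exact main.trans_eq (by ring)

/-- Anisotropic commutator estimate (Fourier-side formulation, via Plancherel):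
for s > 2 and u₂ = R₁²θ, the commutator
∫ (Λ^{s−2}∂₂²(u₂∂₂θ) − u₂Λ^{s−2}∂₂³θ) Λ^{s−2}∂₂²θ dx is bounded by
C‖|ξ|ℱu₂‖_{L¹}‖θ‖²_{H^s} + C‖R₁θ‖²_{H^s}‖θ‖_{H^s}. -/
theorem anisotropic_commutator_estimate (s : ℝ) (hs : 2 < s) :
    ∃ C > 0, ∀ θ : SchwartzMap (EuclideanSpace ℝ (Fin 2)) ℂ,
      let F : EuclideanSpace ℝ (Fin 2) → ℂ := 𝓕 (⇑θ)
      -- Fourier transform of u₂ = −∂₁²(−Δ)^{−1}θ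
      let G : EuclideanSpace ℝ (Fin 2) → ℂ := fun η =>
        ((((η 0) ^ 2 / ‖η‖ ^ 2 : ℝ)) : ℂ) * F η
      -- symbol of Λ^{s−2}∂₂²
      let sym : EuclideanSpace ℝ (Fin 2) → ℂ := fun ξ =>
        ((‖ξ‖ ^ (s - 2) : ℝ) : ℂ) * (2 * (π : ℂ) * Complex.I * ((ξ 1 : ℝ) : ℂ)) ^ 2
      ‖∫ ξ : EuclideanSpace ℝ (Fin 2),
          (∫ η : EuclideanSpace ℝ (Fin 2),
            (sym ξ - sym (ξ - η)) * G η *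
              (2 * (π : ℂ) * Complex.I * (((ξ - η) 1 : ℝ) : ℂ) * F (ξ - η))) *
            (starRingEnd ℂ) (sym ξ * F ξ)‖ ≤
        C * (∫ η : EuclideanSpace ℝ (Fin 2), ‖η‖ * ‖G η‖) *
            (((∫ ξ : EuclideanSpace ℝ (Fin 2),
              (1 + ‖ξ‖ ^ 2) ^ s * ‖F ξ‖ ^ 2) ^ ((1 : ℝ) / 2)) ^ 2) +
          C * (((∫ ξ : EuclideanSpace ℝ (Fin 2),
              (1 + ‖ξ‖ ^ 2) ^ s * ((ξ 0) ^ 2 / ‖ξ‖ ^ 2) * ‖F ξ‖ ^ 2) ^ ((1 : ℝ) / 2)) ^ 2) *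
            (∫ ξ : EuclideanSpace ℝ (Fin 2),
              (1 + ‖ξ‖ ^ 2) ^ s * ‖F ξ‖ ^ 2) ^ ((1 : ℝ) / 2) := by
  obtain ⟨W, hW⟩ : ∃ W, W =
      (∫ x : EuclideanSpace ℝ (Fin 2), (1 + ‖x‖ ^ 2) ^ (1 - s)) ^ (1 / 2 : ℝ) := ⟨_, rfl⟩
  have hW0 : 0 ≤ W := hW ▸ Real.rpow_nonneg (integral_nonneg fun x => by positivity) _
  have hs0 : 0 < s + 2 := by linarith
  refine ⟨(2 * π) ^ 5 * ((s + 2) * 2 ^ (s - 1)) * (1 + 3 * W), by positivity, fun θ => ?_⟩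
  intro F G sym
  have hF : F = ⇑(𝓕 θ : 𝓢(EuclideanSpace ℝ (Fin 2), ℂ)) := (SchwartzMap.fourier_coe θ).symm
  have hsym : ∀ x, sym x = (((-(2 * π) ^ 2) * (‖x‖ ^ (s - 2) * x 1 ^ 2) : ℝ) : ℂ) := fun x => by
    simp only [sym]
    push_cast
    linear_combination (‖x‖ ^ (s - 2) : ℝ) * (2 * (π : ℂ) * (x 1 : ℝ)) ^ 2 * Complex.I_sq
  have hG : ∀ x, ‖G x‖ = (|x 0| / ‖x‖) ^ 2 * ‖F x‖ := fun x => by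
    simp only [G]
    rw [norm_mul, Complex.norm_real, Real.norm_of_nonneg (by positivity), div_pow, sq_abs]
  clear_value sym G
  simp only [← integral_mul_const, hG]
  have key := commutator_integral_le hs (𝓕 θ) (K := (2 * π) ^ 5) (by positivity)
    (Φ := fun ξ η => (sym ξ - sym (ξ - η)) * G η *
      (2 * (π : ℂ) * Complex.I * (((ξ - η) 1 : ℝ) : ℂ) * F (ξ - η)) *
        (starRingEnd ℂ) (sym ξ * F ξ)) fun ξ η => by
    rw [← hF, norm_mul, norm_mul, norm_mul, RCLike.norm_conj, norm_mul, norm_mul, hG, hsym, hsym,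
      ← Complex.ofReal_sub, ← mul_sub, Complex.norm_real, Complex.norm_real, norm_mul, norm_mul,
      norm_mul, norm_mul, Complex.norm_real, Complex.norm_I, Complex.norm_real,
      norm_mul, norm_neg, Real.norm_of_nonneg (by positivity : 0 ≤ (2 * π) ^ 2),
      Real.norm_of_nonneg pi_pos.le, Complex.norm_ofNat]
    simp only [Real.norm_eq_abs]
    exact le_of_eq (by ring)
  rw [← hF, ← hW] at key
  refine key.trans ?_
  have hX0 : 0 ≤ ∫ η, ‖η‖ * ((|η 0| / ‖η‖) ^ 2 * ‖F η‖) := integral_nonneg fun x => by positivity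
  have hA0 : 0 ≤ (∫ ξ, (1 + ‖ξ‖ ^ 2) ^ s * ‖F ξ‖ ^ 2) ^ (1 / 2 : ℝ) :=
    Real.rpow_nonneg (integral_nonneg fun x => by positivity) _
  generalize (∫ ξ, (1 + ‖ξ‖ ^ 2) ^ s * ‖F ξ‖ ^ 2) ^ (1 / 2 : ℝ) = A at *
  generalize (∫ ξ, (1 + ‖ξ‖ ^ 2) ^ s * (ξ 0 ^ 2 / ‖ξ‖ ^ 2) * ‖F ξ‖ ^ 2) ^ (1 / 2 : ℝ) = B at *
  generalize ∫ η, ‖η‖ * ((|η 0| / ‖η‖) ^ 2 * ‖F η‖) = X at *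
  have h1 : 0 ≤ 3 * W * (X * A ^ 2) + B ^ 2 * A := by positivity
  calc _ ≤ (2 * π) ^ 5 * ((s + 2) * 2 ^ (s - 1)) *
        (X * A ^ 2 + 3 * W * B ^ 2 * A + (3 * W * (X * A ^ 2) + B ^ 2 * A)) := by
        exact mul_le_mul_of_nonneg_left (le_add_of_nonneg_right h1) (by positivity)
    _ = _ := by ring
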